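/- arXiv:2010.12386 — 12 statements merged into one kernel-verified Lean document; each statement's English description precedes it below -/
import Mathlib

section
/- For all integers k ≥ 1 and n ≥ 1, the following recurrence holds in ℤ: F_{k(n+1)} = L_k · F_{kn} + (−1)^{k−1} · F_{k(n−1)}; equivalently, dividing by F_k, the Fibonacci divisors satisfy F_{n+1}^{(k)} = L_k F_n^{(k)} + (−1)^{k−1} F_{n−1}^{(k)}. -/
/-- The k-th Lucas number L_k = F_{k+1} + F_{k-1}. -/
def lucas (k : ℕ) : ℕ := Nat.fib (k + 1) + Nat.fib (k - 1)


theorem aux_cassini (j : ℕ) : (Nat.fib (j+1) : ℤ)^2 - Nat.fib j * Nat.fib (j+1) - (Nat.fib j : ℤ)^2 = (-1)^j := by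
  induction j with
  | zero => simp
  | succ j ih =>
    have h : (Nat.fib (j+1+1) : ℤ) = Nat.fib j + Nat.fib (j+1) := by
      exact_mod_cast Nat.fib_add_two (n := j)
    rw [h, pow_succ]
    linear_combination -ih

theorem aux_shift (j m : ℕ) : (Nat.fib (m + (j+1) + (j+1)) : ℤ) =
    (lucas (j+1) : ℤ) * Nat.fib (m + (j+1)) + (-1)^j * Nat.fib m := by
  have h1 : (Nat.fib (m + (j+1)) : ℤ) = Nat.fib m * Nat.fib j + Nat.fib (m+1) * Nat.fib (j+1) := by
    exact_mod_cast Nat.fib_add m j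
  have h2 : (Nat.fib (m + (j+1) + 1) : ℤ) = Nat.fib m * Nat.fib (j+1) + Nat.fib (m+1) * Nat.fib (j+1+1) := by
    exact_mod_cast Nat.fib_add m (j+1)
  have h3 : (Nat.fib (m + (j+1) + (j+1)) : ℤ) = Nat.fib (m+(j+1)) * Nat.fib j + Nat.fib (m+(j+1)+1) * Nat.fib (j+1) := by
    exact_mod_cast Nat.fib_add (m+(j+1)) j
  have h : (Nat.fib (j+1+1) : ℤ) = Nat.fib j + Nat.fib (j+1) := by
    exact_mod_cast Nat.fib_add_two (n := j)
  have hl : (lucas (j+1) : ℤ) = Nat.fib j + Nat.fib (j+1) + Nat.fib j := by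
    rw [← h]; simp [lucas]
  rw [h3, h2, hl, h1, h, ← aux_cassini]
  ring

/-- Recurrence for Fibonacci divisors: for k ≥ 1, n ≥ 1, in ℤ,
    F_{k(n+1)} = L_k F_{kn} + (−1)^{k−1} F_{k(n−1)}, and equivalently, dividing
    by F_k, the Fibonacci divisors F_n^{(k)} = F_{nk}/F_k satisfy
    F_{n+1}^{(k)} = L_k F_n^{(k)} + (−1)^{k−1} F_{n−1}^{(k)}. -/
theorem fib_divisor_recurrence (k n : ℕ) (hk : 1 ≤ k) (hn : 1 ≤ n) :
    ((Nat.fib (k * (n + 1)) : ℤ) =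
      (lucas k : ℤ) * Nat.fib (k * n) + (-1) ^ (k - 1) * Nat.fib (k * (n - 1))) ∧
    ((Nat.fib (k * (n + 1)) : ℤ) / (Nat.fib k : ℤ) =
      (lucas k : ℤ) * ((Nat.fib (k * n) : ℤ) / (Nat.fib k : ℤ)) +
        (-1) ^ (k - 1) * ((Nat.fib (k * (n - 1)) : ℤ) / (Nat.fib k : ℤ))) := by
  obtain ⟨j, rfl⟩ : ∃ j, k = j + 1 := ⟨k - 1, by omega⟩
  obtain ⟨p, rfl⟩ : ∃ p, n = p + 1 := ⟨n - 1, by omega⟩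
  have key := aux_shift j ((j+1) * p)
  have e1 : (j+1) * p + (j+1) + (j+1) = (j+1) * (p+1+1) := by ring
  have e2 : (j+1) * p + (j+1) = (j+1) * (p+1) := by ring
  rw [e1, e2] at key
  simp only [Nat.add_sub_cancel]
  refine ⟨key, ?_⟩
  have hd : ∀ q, (Nat.fib (j+1) : ℤ) ∣ (Nat.fib ((j+1) * q) : ℤ) := fun q =>
    Int.natCast_dvd_natCast.mpr (Nat.fib_dvd _ _ (Dvd.intro q rfl))
  have hpos : (Nat.fib (j+1) : ℤ) ≠ 0 := by
    exact_mod_cast (Nat.fib_pos.mpr (Nat.succ_pos j)).ne'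
  rw [key]
  obtain ⟨a, ha⟩ := hd (p+1)
  obtain ⟨b, hb⟩ := hd p
  rw [ha, hb, Int.mul_ediv_cancel_left _ hpos, Int.mul_ediv_cancel_left _ hpos]
  apply Int.ediv_eq_of_eq_mul_right hpos
  ring
end

section
/- Define, for nonzero integers k and arbitrary integers n, the real number G(k,n) = (φ^{kn} − φ'^{kn})/(φ^k − φ'^k), where powers are integer (zpow) powers. Then for all integers k ≠ 0 and n: (i) G(k, −n) = (−1)^{kn+1} G(k, n); (ii) G(−k, n) = (−1)^{(n+1)k} G(k, n); (iii) G(−k, −n) = (−1)^{k+1} G(k, n). (For k, n ≥ 1, G(k,n) equals the Fibonacci divisor F_n^{(k)} = F_{nk}/F_k, so these formulas extend Fibonacci divisors to negative indices.) -/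
noncomputable def gphi : ℝ := (1 + Real.sqrt 5) / 2
noncomputable def gphi' : ℝ := (1 - Real.sqrt 5) / 2

/-- Extension of Fibonacci divisors to negative indices via
    G(k,n) = (φ^{kn} − φ'^{kn})/(φ^k − φ'^k), with integer (zpow) powers. -/
noncomputable def G (k n : ℤ) : ℝ :=
  (gphi ^ (k * n) - gphi' ^ (k * n)) / (gphi ^ k - gphi' ^ k)

theorem gphi_mul : gphi * gphi' = -1 := by
  have h : Real.sqrt 5 * Real.sqrt 5 = 5 := Real.mul_self_sqrt (by norm_num)
  unfold gphi gphi'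
  linear_combination (-1 / 4) * h

theorem aux_D (m : ℤ) :
    gphi ^ (-m) - gphi' ^ (-m) = (-1 : ℝ) ^ (m + 1) * (gphi ^ m - gphi' ^ m) := by
  have hm := gphi_mul
  have h1 : gphi ≠ 0 := by
    intro h
    rw [h] at hm
    norm_num at hm
  have h2 : gphi' ≠ 0 := by
    intro h
    rw [h] at hm
    norm_num at hm
  have hp : gphi ^ m * gphi' ^ m = (-1 : ℝ) ^ m := by
    rw [← mul_zpow, hm]
  have a1 := zpow_ne_zero m h1
  have a2 := zpow_ne_zero m h2
  rw [zpow_add₀ (by norm_num), zpow_one, ← hp, zpow_neg, zpow_neg]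
  have hs : (gphi ^ m * gphi' ^ m) * (gphi ^ m * gphi' ^ m) = 1 := by
    rw [hp, ← mul_zpow]
    norm_num
  field_simp
  linear_combination (gphi ^ m - gphi' ^ m) * hs

theorem aux_inv (m : ℤ) : ((-1 : ℝ) ^ m)⁻¹ = (-1) ^ m := by
  rw [← inv_zpow]
  norm_num

/-- For all integers k ≠ 0 and n:
    (i) G(k, −n) = (−1)^{kn+1} G(k, n);
    (ii) G(−k, n) = (−1)^{(n+1)k} G(k, n);
    (iii) G(−k, −n) = (−1)^{k+1} G(k, n). -/
theorem fib_divisor_negative_indices (k n : ℤ) (hk : k ≠ 0) :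
    G k (-n) = (-1 : ℝ) ^ (k * n + 1) * G k n ∧
    G (-k) n = (-1 : ℝ) ^ ((n + 1) * k) * G k n ∧
    G (-k) (-n) = (-1 : ℝ) ^ (k + 1) * G k n := by
  have hne : (-1 : ℝ) ≠ 0 := by norm_num
  refine ⟨?_, ?_, ?_⟩
  · unfold G
    rw [mul_neg, aux_D, mul_div_assoc]
  · unfold G
    rw [neg_mul, aux_D, aux_D, mul_div_mul_comm, div_eq_mul_inv ((-1 : ℝ) ^ _), aux_inv,
      ← zpow_add₀ hne]
    have e : k * n + 1 + (k + 1) = (n + 1) * k + 2 := by ring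
    rw [e, zpow_add₀ hne]
    norm_num
  · unfold G
    rw [neg_mul_neg, aux_D, div_mul_eq_div_div_swap, div_right_comm, div_eq_mul_inv _ ((-1 : ℝ) ^ _), aux_inv, mul_comm]
    try ring
end

section
/- For all integers k ≥ 1 and n ≥ 1, the powers of the golden ratio are expressed through Fibonacci divisors: (φ^k)^n = φ^k · (F_{nk} : ℝ)/F_k + (−1)^{k+1} · (F_{(n−1)k} : ℝ)/F_k, and likewise (φ'^k)^n = φ'^k · (F_{nk} : ℝ)/F_k + (−1)^{k+1} · (F_{(n−1)k} : ℝ)/F_k. -/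
/-- For k ≥ 1 and n ≥ 1, powers of the golden ratio through Fibonacci divisors:
    (φ^k)^n = φ^k · F_{nk}/F_k + (−1)^{k+1} · F_{(n−1)k}/F_k, and likewise for φ'. -/
theorem golden_power_fib_divisor (k n : ℕ) (hk : 1 ≤ k) (hn : 1 ≤ n) :
    ((gphi ^ k) ^ n =
      gphi ^ k * ((Nat.fib (n * k) : ℝ) / (Nat.fib k : ℝ)) +
        (-1 : ℝ) ^ (k + 1) * ((Nat.fib ((n - 1) * k) : ℝ) / (Nat.fib k : ℝ))) ∧
    ((gphi' ^ k) ^ n =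
      gphi' ^ k * ((Nat.fib (n * k) : ℝ) / (Nat.fib k : ℝ)) +
        (-1 : ℝ) ^ (k + 1) * ((Nat.fib ((n - 1) * k) : ℝ) / (Nat.fib k : ℝ))) := by
  obtain ⟨m, rfl⟩ : ∃ m, n = m + 1 := ⟨n - 1, by omega⟩
  have hF : (Nat.fib k : ℝ) ≠ 0 := by
    have := Nat.fib_pos.2 hk
    positivity
  have h5 : Real.sqrt 5 ≠ 0 := by positivity
  have hb : ∀ j : ℕ, (Nat.fib (j * k) : ℝ) * Real.sqrt 5 = (gphi ^ k) ^ j - (gphi' ^ k) ^ j := by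
    intro j
    rw [Real.coe_fib_eq, div_mul_cancel₀ _ h5, mul_comm j k, pow_mul, pow_mul]
    rfl
  have hk1 := hb 1
  rw [one_mul, pow_one, pow_one] at hk1
  have hab : (-1 : ℝ) ^ (k + 1) = -(gphi ^ k * gphi' ^ k) := by
    have h : gphi * gphi' = -1 := Real.goldenRatio_mul_goldenConj
    rw [← mul_pow, h, pow_succ]
    ring
  have h1 := hb (m + 1)
  have h2 := hb m
  rw [Nat.add_sub_cancel, hab]
  generalize gphi ^ k = a at *
  generalize gphi' ^ k = b at *
  constructor
  · field_simp
    apply mul_right_cancel₀ h5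
    linear_combination a ^ (m + 1) * hk1 - a * h1 + a * b * h2
  · field_simp
    apply mul_right_cancel₀ h5
    linear_combination b ^ (m + 1) * hk1 - b * h1 + a * b * h2
end

section
/- For all integers k ≥ 1 and natural numbers m ≤ n, the Fibonacci divisors satisfy, as real numbers, F_n^{(k)} = F_m^{(k)} · φ^{k(n−m)} + F_{n−m}^{(k)} · φ'^{km}. -/
/-- For k ≥ 1 and m ≤ n, in ℝ:
    F_n^{(k)} = F_m^{(k)} · φ^{k(n−m)} + F_{n−m}^{(k)} · φ'^{km},
    where F_n^{(k)} = F_{nk}/F_k. -/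
theorem fib_divisor_split (k n m : ℕ) (hk : 1 ≤ k) (hmn : m ≤ n) :
    (Nat.fib (n * k) : ℝ) / (Nat.fib k : ℝ) =
      ((Nat.fib (m * k) : ℝ) / (Nat.fib k : ℝ)) * gphi ^ (k * (n - m)) +
        ((Nat.fib ((n - m) * k) : ℝ) / (Nat.fib k : ℝ)) * gphi' ^ (k * m) := by
  obtain ⟨d, rfl⟩ := Nat.exists_eq_add_of_le hmn
  have h1 : gphi = Real.goldenRatio := rfl
  have h2 : gphi' = Real.goldenConj := rfl
  rw [Nat.add_sub_cancel_left, h1, h2, Real.coe_fib_eq ((m + d) * k), Real.coe_fib_eq (m * k),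
    Real.coe_fib_eq (d * k), add_mul, pow_add, pow_add, mul_comm k d, mul_comm k m]
  ring
end

section
/- For all integers k ≥ 1 and natural numbers m, n with m + 1 ≤ n, the Fibonacci divisors satisfy F_n^{(k)} = F_{n−m}^{(k)} · F_{m+1}^{(k)} + (−1)^{k+1} · F_m^{(k)} · F_{n−m−1}^{(k)}; equivalently, multiplying through by F_k², in ℤ: F_{nk} · F_k = F_{(n−m)k} · F_{(m+1)k} + (−1)^{k+1} · F_{mk} · F_{(n−m−1)k}. For k = 1 this reduces to the addition formula F_n = F_{n−m} F_{m+1} + F_m F_{n−m−1}. -/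
lemma fib_docagne_aux (b k : ℕ) : (Nat.fib (1 + b + k) : ℤ) * Nat.fib k =
    Nat.fib (1 + k) * Nat.fib (b + k) + (-1) ^ (k + 1) * Nat.fib b := by
  induction k with
  | zero => simp
  | succ k ih =>
    have h1 : (Nat.fib (1 + b + (k + 1)) : ℤ) = Nat.fib (b + k) + Nat.fib (1 + b + k) := by
      rw [show 1 + b + (k + 1) = (b + k) + 2 by ring, Nat.fib_add_two,
        show 1 + b + k = b + k + 1 by ring]
      push_cast; ring
    have h2 : (Nat.fib (1 + (k + 1)) : ℤ) = Nat.fib k + Nat.fib (1 + k) := by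
      rw [show 1 + (k + 1) = k + 2 by ring, Nat.fib_add_two, show 1 + k = k + 1 by ring]
      push_cast; ring
    rw [h1, h2, show b + (k + 1) = 1 + b + k by ring, show k + 1 = 1 + k by ring]
    rw [show 1 + k + 1 = (k + 1) + 1 by ring, pow_succ]
    linear_combination -ih

lemma fib_vajda_aux (b k a : ℕ) : (Nat.fib (a + b + k) : ℤ) * Nat.fib k =
    Nat.fib (a + k) * Nat.fib (b + k) + (-1) ^ (k + 1) * Nat.fib b * Nat.fib a := by
  induction a using Nat.twoStepInduction with
  | zero => simp; ring
  | one => simpa using fib_docagne_aux b k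
  | more a h0 h1 =>
    rw [show a + 2 + b + k = (a + b + k) + 2 by ring, show a + 2 + k = (a + k) + 2 by ring,
      Nat.fib_add_two, Nat.fib_add_two, Nat.fib_add_two]
    rw [show a + 1 + b + k = (a + b + k) + 1 by ring, show a + 1 + k = (a + k) + 1 by ring] at h1
    push_cast
    linear_combination h0 + h1

/-- Addition-type formula for Fibonacci divisors: for k ≥ 1, m + 1 ≤ n,
    F_n^{(k)} = F_{n−m}^{(k)} F_{m+1}^{(k)} + (−1)^{k+1} F_m^{(k)} F_{n−m−1}^{(k)}
    (as an identity of rationals, where F_n^{(k)} = F_{nk}/F_k), equivalently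
    multiplying through by F_k², in ℤ:
    F_{nk} · F_k = F_{(n−m)k} · F_{(m+1)k} + (−1)^{k+1} · F_{mk} · F_{(n−m−1)k}. -/
theorem fib_divisor_addition (k n m : ℕ) (hk : 1 ≤ k) (hmn : m + 1 ≤ n) :
    ((Nat.fib (n * k) : ℚ) / (Nat.fib k : ℚ) =
      ((Nat.fib ((n - m) * k) : ℚ) / (Nat.fib k : ℚ)) *
        ((Nat.fib ((m + 1) * k) : ℚ) / (Nat.fib k : ℚ)) +
      (-1 : ℚ) ^ (k + 1) * ((Nat.fib (m * k) : ℚ) / (Nat.fib k : ℚ)) *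
        ((Nat.fib ((n - m - 1) * k) : ℚ) / (Nat.fib k : ℚ))) ∧
    ((Nat.fib (n * k) : ℤ) * Nat.fib k =
      (Nat.fib ((n - m) * k) : ℤ) * Nat.fib ((m + 1) * k) +
        (-1) ^ (k + 1) * Nat.fib (m * k) * Nat.fib ((n - m - 1) * k)) := by
  have key : ((Nat.fib (n * k) : ℤ) * Nat.fib k =
      (Nat.fib ((n - m) * k) : ℤ) * Nat.fib ((m + 1) * k) +
        (-1) ^ (k + 1) * Nat.fib (m * k) * Nat.fib ((n - m - 1) * k)) := by
    obtain ⟨d, rfl⟩ := Nat.exists_eq_add_of_le hmn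
    have e1 : m + 1 + d - m = d + 1 := by omega
    rw [e1, Nat.add_sub_cancel]
    have := fib_vajda_aux (m * k) k (d * k)
    rw [show (m + 1 + d) * k = d * k + m * k + k by ring,
      show (d + 1) * k = d * k + k by ring, show (m + 1) * k = m * k + k by ring]
    exact this
  refine ⟨?_, key⟩
  have hF : (Nat.fib k : ℚ) ≠ 0 := by
    exact_mod_cast (Nat.fib_pos.2 hk).ne'
  have keyQ : ((Nat.fib (n * k) : ℚ) * Nat.fib k =
      (Nat.fib ((n - m) * k) : ℚ) * Nat.fib ((m + 1) * k) +
        (-1) ^ (k + 1) * Nat.fib (m * k) * Nat.fib ((n - m - 1) * k)) := by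
    exact_mod_cast key
  field_simp
  linear_combination keyQ
end

section
/- Every Golden periodic function is k-th Golden periodic for every k ≥ 1: if f : ℝ → ℝ satisfies f(φ x) = f(φ' x) for all x ∈ ℝ, then for every integer k ≥ 1 and all x ∈ ℝ, f(φ^k x) = f(φ'^k x). -/
/-- Every Golden periodic function is k-th Golden periodic for every k ≥ 1:
    if f(φ x) = f(φ' x) for all x, then f(φ^k x) = f(φ'^k x) for all x. -/
theorem golden_periodic_implies_kth (f : ℝ → ℝ)
    (hf : ∀ x : ℝ, f (gphi * x) = f (gphi' * x)) :
    ∀ k : ℕ, 1 ≤ k → ∀ x : ℝ, f (gphi ^ k * x) = f (gphi' ^ k * x) := by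
  intro k _
  induction k with
  | zero => intro x; simp
  | succ n ih =>
    intro x
    have ih' : ∀ x : ℝ, f (gphi ^ n * x) = f (gphi' ^ n * x) := by
      rcases Nat.eq_zero_or_pos n with h | h
      · subst h; intro x; simp
      · exact ih h
    calc f (gphi ^ (n + 1) * x) = f (gphi * (gphi ^ n * x)) := by congr 1; ring
      _ = f (gphi' * (gphi ^ n * x)) := hf _
      _ = f (gphi ^ n * (gphi' * x)) := by congr 1; ring
      _ = f (gphi' ^ n * (gphi' * x)) := ih' _
      _ = f (gphi' ^ (n + 1) * x) := by congr 1; ring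
end

section
/- Generating function for Fibonacci divisors: for every integer k ≥ 1 and every real x with |x| < φ^{−k}, the series ∑_{n=0}^∞ F_n^{(k)} x^n converges and has sum x / (1 − L_k x + (−1)^k x²); equivalently, HasSum (fun n ↦ ((F_{nk} : ℝ)/F_k) · x^n) (x / (1 − L_k x + (−1)^k x²)). -/
/-- Generating function for Fibonacci divisors: for k ≥ 1 and |x| < φ^{−k},
    ∑_{n} F_n^{(k)} x^n = x / (1 − L_k x + (−1)^k x²),
    where F_n^{(k)} = F_{nk}/F_k. -/
theorem fib_divisor_generating_function (k : ℕ) (hk : 1 ≤ k) (x : ℝ)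
    (hx : |x| < (gphi ^ k)⁻¹) :
    HasSum (fun n : ℕ => ((Nat.fib (n * k) : ℝ) / (Nat.fib k : ℝ)) * x ^ n)
      (x / (1 - (lucas k : ℝ) * x + (-1 : ℝ) ^ k * x ^ 2)) := by
  have hg : gphi = Real.goldenRatio := rfl
  rw [hg] at hx
  obtain ⟨m, rfl⟩ : ∃ m, k = m + 1 := ⟨k - 1, by omega⟩
  have hL : (lucas (m + 1) : ℝ) = Real.goldenRatio ^ (m + 1) + Real.goldenConj ^ (m + 1) := by
    rw [← Real.goldenRatio_mul_fib_succ_add_fib, ← Real.goldenConj_mul_fib_succ_add_fib]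
    have h := Real.goldenRatio_add_goldenConj
    simp only [lucas, Nat.add_sub_cancel, Nat.fib_add_two (n := m)]
    push_cast
    linear_combination -(Nat.fib (m + 1) : ℝ) * h
  have hab : Real.goldenRatio ^ (m + 1) * Real.goldenConj ^ (m + 1) = (-1) ^ (m + 1) := by
    rw [← mul_pow, Real.goldenRatio_mul_goldenConj]
  have hFpos : (Nat.fib (m + 1) : ℝ) ≠ 0 := by
    exact_mod_cast (Nat.fib_pos.2 (Nat.succ_pos m)).ne'
  have hF := Real.coe_fib_eq (m + 1)
  have hfun : ∀ n : ℕ, (Nat.fib (n * (m + 1)) : ℝ) =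
      ((Real.goldenRatio ^ (m + 1)) ^ n - (Real.goldenConj ^ (m + 1)) ^ n) / √5 := by
    intro n
    rw [Real.coe_fib_eq, ← pow_mul, ← pow_mul, mul_comm n]
  have hapos : 0 < Real.goldenRatio ^ (m + 1) := pow_pos Real.goldenRatio_pos _
  have hba : |Real.goldenConj ^ (m + 1)| ≤ Real.goldenRatio ^ (m + 1) := by
    rw [abs_pow]
    apply pow_le_pow_left₀ (abs_nonneg _)
    rw [abs_of_neg Real.goldenConj_neg]
    linarith [Real.goldenRatio_add_goldenConj]
  simp only [hfun]
  rw [hL, ← hab]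
  rw [hF] at hFpos ⊢
  generalize Real.goldenRatio ^ (m + 1) = a at *
  generalize Real.goldenConj ^ (m + 1) = b at *
  have h5 : √(5 : ℝ) ≠ 0 := by positivity
  have hd : a - b ≠ 0 := fun h => hFpos (by simp [h])
  have hax : a * |x| < 1 := by
    calc a * |x| < a * a⁻¹ := by gcongr
      _ = 1 := mul_inv_cancel₀ hapos.ne'
  have h1 : |a * x| < 1 := by rwa [abs_mul, abs_of_pos hapos]
  have h2 : |b * x| < 1 := by
    rw [abs_mul]
    exact lt_of_le_of_lt (mul_le_mul_of_nonneg_right hba (abs_nonneg x)) hax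
  have n1 : 1 - a * x ≠ 0 := (sub_pos.2 (abs_lt.1 h1).2).ne'
  have n2 : 1 - b * x ≠ 0 := (sub_pos.2 (abs_lt.1 h2).2).ne'
  have key := ((hasSum_geometric_of_abs_lt_one h1).sub
    (hasSum_geometric_of_abs_lt_one h2)).mul_left (a - b)⁻¹
  convert key using 1
  · rfl
  · funext n
    rw [mul_pow, mul_pow]
    field_simp
  · have e : 1 - (a + b) * x + a * b * x ^ 2 = (1 - a * x) * (1 - b * x) := by ring
    rw [e, inv_sub_inv n1 n2, inv_mul_eq_div, div_div,
      div_eq_div_iff (mul_ne_zero n1 n2) (mul_ne_zero (mul_ne_zero n1 n2) hd)]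
    ring
end

section
/- Entire generating function for Fibonacci divisors: for every integer k ≥ 1 and every real x, ∑_{n=0}^∞ (F_n^{(k)}/n!) x^n = exp(L_k x/2) · sinh(F_k (√5/2) x) / (F_k √5/2); that is, HasSum (fun n ↦ ((F_{nk} : ℝ)/F_k) · x^n / n!) (exp(L_k x/2) · sinh(F_k (√5/2) x) / (F_k √5/2)). (The n = 0 term vanishes since F_0^{(k)} = 0.) -/
/-- Entire generating function for Fibonacci divisors: for k ≥ 1 and every real x,
    ∑_{n} (F_n^{(k)}/n!) x^n = exp(L_k x/2) · sinh(F_k (√5/2) x) / (F_k √5/2). -/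
theorem fib_divisor_entire_generating_function (k : ℕ) (hk : 1 ≤ k) (x : ℝ) :
    HasSum (fun n : ℕ => ((Nat.fib (n * k) : ℝ) / (Nat.fib k : ℝ)) * x ^ n / n.factorial)
      (Real.exp ((lucas k : ℝ) * x / 2) *
        Real.sinh ((Nat.fib k : ℝ) * (Real.sqrt 5 / 2) * x) /
          ((Nat.fib k : ℝ) * Real.sqrt 5 / 2)) := by
  obtain ⟨m, rfl⟩ : ∃ m, k = m + 1 := ⟨k - 1, by omega⟩
  have hF : (0 : ℝ) < (Nat.fib (m + 1) : ℝ) := by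
    exact_mod_cast Nat.fib_pos.2 (Nat.succ_pos m)
  have h5 : (0 : ℝ) < Real.sqrt 5 := by positivity
  have hL : (lucas (m + 1) : ℝ) = 2 * (Nat.fib m : ℝ) + (Nat.fib (m + 1) : ℝ) := by
    simp only [lucas, Nat.fib_add_two, Nat.add_sub_cancel]
    push_cast
    ring
  have hA := Real.goldenRatio_mul_fib_succ_add_fib m
  have hB := Real.goldenConj_mul_fib_succ_add_fib m
  have h1 : HasSum (fun n : ℕ => (Real.goldenRatio ^ (m + 1) * x) ^ n / (n.factorial : ℝ))
      (Real.exp (Real.goldenRatio ^ (m + 1) * x)) := by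
    rw [Real.exp_eq_exp_ℝ]
    exact NormedSpace.expSeries_div_hasSum_exp _
  have h2 : HasSum (fun n : ℕ => (Real.goldenConj ^ (m + 1) * x) ^ n / (n.factorial : ℝ))
      (Real.exp (Real.goldenConj ^ (m + 1) * x)) := by
    rw [Real.exp_eq_exp_ℝ]
    exact NormedSpace.expSeries_div_hasSum_exp _
  have e1 : Real.goldenRatio ^ (m + 1) * x = (lucas (m + 1) : ℝ) * x / 2
      + (Nat.fib (m + 1) : ℝ) * (Real.sqrt 5 / 2) * x := by
    rw [← hA, hL, Real.goldenRatio]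
    ring
  have e2 : Real.goldenConj ^ (m + 1) * x = (lucas (m + 1) : ℝ) * x / 2
      + -((Nat.fib (m + 1) : ℝ) * (Real.sqrt 5 / 2) * x) := by
    rw [← hB, hL, Real.goldenConj]
    ring
  have h3 := (h1.sub h2).div_const ((Nat.fib (m + 1) : ℝ) * Real.sqrt 5)
  convert! h3 using 1
  · funext n
    rw [Real.coe_fib_eq (n * (m + 1)), mul_comm n (m + 1), pow_mul, pow_mul, mul_pow, mul_pow]
    field_simp
  · rw [e1, e2, Real.exp_add, Real.exp_add, Real.sinh_eq]
    field_simp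
end

section
/- The k-th Golden exponential is an eigenfunction of the k-th Golden derivative: for every integer k ≥ 1, every λ ∈ ℝ, and every x ≠ 0, (e_F(λ φ^k x) − e_F(λ φ'^k x)) / ((φ^k − φ'^k) x) = λ · e_F(λ x), where e_F(t) = ∑_{n=0}^∞ t^n / F_n^{(k)}! is the k-th Golden exponential (the series converges for all real t). -/
/-- The Fibonacci divisor factorial F_n^{(k)}! = ∏_{i=1}^n F_i^{(k)},
    where F_i^{(k)} = F_{ik}/F_k (empty product 1 for n = 0). -/
noncomputable def fibDivFact (k n : ℕ) : ℝ :=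
  ∏ i ∈ Finset.range n, ((Nat.fib ((i + 1) * k) : ℝ) / (Nat.fib k : ℝ))

/-- The k-th Golden exponential e_F(t) = ∑_{n} t^n / F_n^{(k)}!. -/
noncomputable def goldenExp (k : ℕ) (t : ℝ) : ℝ := ∑' n : ℕ, t ^ n / fibDivFact k n

theorem aux_binet (n : ℕ) : gphi ^ n - gphi' ^ n = Real.sqrt 5 * (Nat.fib n : ℝ) := by
  have h := Real.coe_fib_eq n
  have h5 : Real.sqrt 5 ≠ 0 := by positivity
  rw [h]
  field_simp
  rfl

theorem aux_fact_succ (k n : ℕ) : fibDivFact k (n + 1) =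
    fibDivFact k n * ((Nat.fib ((n + 1) * k) : ℝ) / (Nat.fib k : ℝ)) := by
  unfold fibDivFact
  rw [Finset.prod_range_succ]

theorem aux_fib_pos (k : ℕ) (hk : 1 ≤ k) (n : ℕ) : (0 : ℝ) < Nat.fib ((n + 1) * k) := by
  have : 0 < (n + 1) * k := by positivity
  exact_mod_cast Nat.fib_pos.2 this

theorem aux_fact_pos (k : ℕ) (hk : 1 ≤ k) (n : ℕ) : 0 < fibDivFact k n := by
  unfold fibDivFact
  refine Finset.prod_pos fun i _ => div_pos (aux_fib_pos k hk i) ?_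
  exact_mod_cast Nat.fib_pos.2 hk

theorem aux_summable (k : ℕ) (hk : 1 ≤ k) (t : ℝ) :
    Summable (fun n : ℕ => t ^ n / fibDivFact k n) := by
  refine summable_of_ratio_norm_eventually_le (r := 1 / 2) (by norm_num) ?_
  obtain ⟨N, hN⟩ := exists_nat_ge (2 * |t| * Nat.fib k)
  filter_upwards [Filter.eventually_ge_atTop N] with n hn
  have h1 : n ≤ Nat.fib ((n + 1) * k) := by
    have := Nat.le_fib_add_one ((n + 1) * k)
    have h2 : n + 1 ≤ (n + 1) * k := Nat.le_mul_of_pos_right _ hk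
    omega
  have h1' : (n : ℝ) ≤ Nat.fib ((n + 1) * k) := by exact_mod_cast h1
  have hn' : (N : ℝ) ≤ n := by exact_mod_cast hn
  have hp := aux_fact_pos k hk n
  have hF := aux_fib_pos k hk n
  have hK : (0 : ℝ) < Nat.fib k := by exact_mod_cast Nat.fib_pos.2 hk
  rw [aux_fact_succ, Real.norm_eq_abs, Real.norm_eq_abs, abs_div, abs_div, abs_pow, abs_pow,
    abs_of_pos hp, abs_of_pos (mul_pos hp (div_pos hF hK))]
  have e : |t| ^ (n + 1) / (fibDivFact k n * ((Nat.fib ((n + 1) * k) : ℝ) / (Nat.fib k : ℝ)))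
      = (|t| * Nat.fib k / Nat.fib ((n + 1) * k)) * (|t| ^ n / fibDivFact k n) := by
    field_simp
    ring
  rw [e]
  refine mul_le_mul_of_nonneg_right ?_ (by positivity)
  rw [div_le_iff₀ hF]
  linarith

theorem goldenExp_eigenfunction (k : ℕ) (hk : 1 ≤ k) (lam : ℝ) (x : ℝ) (hx : x ≠ 0) :
    (∀ t : ℝ, Summable (fun n : ℕ => t ^ n / fibDivFact k n)) ∧
    (goldenExp k (lam * (gphi ^ k * x)) - goldenExp k (lam * (gphi' ^ k * x))) /
        ((gphi ^ k - gphi' ^ k) * x) = lam * goldenExp k (lam * x) := by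
  refine ⟨aux_summable k hk, ?_⟩
  have hK : (0 : ℝ) < Nat.fib k := by exact_mod_cast Nat.fib_pos.2 hk
  have h5 : (0 : ℝ) < Real.sqrt 5 := by positivity
  have hd : (gphi ^ k - gphi' ^ k) * x ≠ 0 := by
    rw [aux_binet]
    exact mul_ne_zero (mul_pos h5 hK).ne' hx
  rw [div_eq_iff hd]
  unfold goldenExp
  have s1 := aux_summable k hk (lam * (gphi ^ k * x))
  have s2 := aux_summable k hk (lam * (gphi' ^ k * x))
  rw [← s1.tsum_sub s2, (s1.sub s2).tsum_eq_zero_add, mul_right_comm, ← tsum_mul_left]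
  simp only [pow_zero, sub_self, zero_add]
  refine tsum_congr fun n => ?_
  have hp := aux_fact_pos k hk n
  have hF := aux_fib_pos k hk n
  have hb := aux_binet ((n + 1) * k)
  have e : (lam * (gphi ^ k * x)) ^ (n + 1) - (lam * (gphi' ^ k * x)) ^ (n + 1)
      = (lam * x) ^ (n + 1) * (gphi ^ ((n + 1) * k) - gphi' ^ ((n + 1) * k)) := by
    rw [mul_comm (n + 1) k, pow_mul, pow_mul]
    simp only [mul_pow]
    ring
  rw [← sub_div, e, hb, aux_binet, aux_fact_succ]
  field_simp
  ring
end

section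
/- Factorization property of k-th Golden binomials: for every integer k ≥ 1, all natural numbers n, m, and all real x, a: (x − a)^{n+m}_{F,k} = (x − φ^{km} a)^n_{F,k} · (x − φ'^{kn} a)^m_{F,k}; explicitly, ∏_{j=0}^{n+m−1} (x − φ^{k(n+m−1−j)} φ'^{kj} a) = [∏_{j=0}^{n−1} (x − φ^{k(n−1−j)} φ'^{kj} · φ^{km} a)] · [∏_{j=0}^{m−1} (x − φ^{k(m−1−j)} φ'^{kj} · φ'^{kn} a)]. -/
/-- Factorization property of k-th Golden binomials: for k ≥ 1, n, m : ℕ, x a : ℝ,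
    (x − a)^{n+m}_{F,k} = (x − φ^{km} a)^n_{F,k} · (x − φ'^{kn} a)^m_{F,k}, where
    (x − a)^n_{F,k} = ∏_{j=0}^{n−1} (x − φ^{k(n−1−j)} φ'^{kj} a). -/
theorem golden_binomial_factorization (k : ℕ) (hk : 1 ≤ k) (n m : ℕ) (x a : ℝ) :
    (∏ j ∈ Finset.range (n + m), (x - gphi ^ (k * (n + m - 1 - j)) * gphi' ^ (k * j) * a)) =
      (∏ j ∈ Finset.range n,
        (x - gphi ^ (k * (n - 1 - j)) * gphi' ^ (k * j) * (gphi ^ (k * m) * a))) *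
      (∏ j ∈ Finset.range m,
        (x - gphi ^ (k * (m - 1 - j)) * gphi' ^ (k * j) * (gphi' ^ (k * n) * a))) := by
  rw [Finset.prod_range_add]
  congr 1
  · refine Finset.prod_congr rfl fun j hj => ?_
    have hj := Finset.mem_range.1 hj
    have h : n + m - 1 - j = (n - 1 - j) + m := by omega
    rw [h, mul_add, pow_add]
    ring
  · refine Finset.prod_congr rfl fun j hj => ?_
    have h : n + m - 1 - (n + j) = m - 1 - j := by omega
    rw [h, mul_add, pow_add]
    ring
end

section
/- The k-th Golden derivative acts on k-th Golden binomials by lowering the degree: for every integer k ≥ 1, every natural number n ≥ 1, every real y, and every x ≠ 0, (B_n(φ^k x, y) − B_n(φ'^k x, y)) / ((φ^k − φ'^k) x) = F_n^{(k)} · B_{n−1}(x, y), where B_n(x, y) = ∏_{j=0}^{n−1} (x + φ^{k(n−1−j)} φ'^{kj} y) is the k-th Golden binomial. -/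
/-- The k-th Golden binomial B_n(x, y) = ∏_{j=0}^{n−1} (x + φ^{k(n−1−j)} φ'^{kj} y),
    with B_0 = 1. -/
noncomputable def goldenBinomial (k n : ℕ) (x y : ℝ) : ℝ :=
  ∏ j ∈ Finset.range n, (x + gphi ^ (k * (n - 1 - j)) * gphi' ^ (k * j) * y)

theorem gb_phi (k m : ℕ) (x y : ℝ) :
    goldenBinomial k (m + 1) (gphi ^ k * x) y =
      (gphi ^ k) ^ m * goldenBinomial k m x y * (gphi ^ k * x + gphi' ^ (k * m) * y) := by
  unfold goldenBinomial
  rw [Finset.prod_range_succ]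
  have h : ∏ j ∈ Finset.range m,
      (gphi ^ k * x + gphi ^ (k * (m + 1 - 1 - j)) * gphi' ^ (k * j) * y) =
      ∏ j ∈ Finset.range m,
      (gphi ^ k * (x + gphi ^ (k * (m - 1 - j)) * gphi' ^ (k * j) * y)) := by
    refine Finset.prod_congr rfl fun j hj => ?_
    have hj := Finset.mem_range.1 hj
    have e : m + 1 - 1 - j = (m - 1 - j) + 1 := by omega
    rw [e]
    ring
  rw [h, Finset.prod_mul_distrib]
  simp

theorem gb_psi (k m : ℕ) (x y : ℝ) :
    goldenBinomial k (m + 1) (gphi' ^ k * x) y =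
      (gphi' ^ k) ^ m * goldenBinomial k m x y * (gphi' ^ k * x + gphi ^ (k * m) * y) := by
  unfold goldenBinomial
  rw [Finset.prod_range_succ']
  have h : ∏ j ∈ Finset.range m,
      (gphi' ^ k * x + gphi ^ (k * (m + 1 - 1 - (j + 1))) * gphi' ^ (k * (j + 1)) * y) =
      ∏ j ∈ Finset.range m,
      (gphi' ^ k * (x + gphi ^ (k * (m - 1 - j)) * gphi' ^ (k * j) * y)) := by
    refine Finset.prod_congr rfl fun j hj => ?_
    have e : m + 1 - 1 - (j + 1) = m - 1 - j := by omega
    rw [e]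
    ring
  rw [h, Finset.prod_mul_distrib]
  simp

/-- The k-th Golden derivative lowers the degree of k-th Golden binomials:
    for k ≥ 1, n ≥ 1, y : ℝ and x ≠ 0,
    (B_n(φ^k x, y) − B_n(φ'^k x, y)) / ((φ^k − φ'^k) x) = F_n^{(k)} · B_{n−1}(x, y),
    where F_n^{(k)} = F_{nk}/F_k. -/
theorem goldenDeriv_goldenBinomial (k n : ℕ) (hk : 1 ≤ k) (hn : 1 ≤ n)
    (y : ℝ) (x : ℝ) (hx : x ≠ 0) :
    (goldenBinomial k n (gphi ^ k * x) y - goldenBinomial k n (gphi' ^ k * x) y) /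
        ((gphi ^ k - gphi' ^ k) * x) =
      ((Nat.fib (n * k) : ℝ) / (Nat.fib k : ℝ)) * goldenBinomial k (n - 1) x y := by
  obtain ⟨m, rfl⟩ : ∃ m, n = m + 1 := ⟨n - 1, by omega⟩
  have h5 : Real.sqrt 5 ≠ 0 := by positivity
  have hf : ∀ i : ℕ, (Nat.fib i : ℝ) = (gphi ^ i - gphi' ^ i) / Real.sqrt 5 :=
    Real.coe_fib_eq
  have hk0 : (Nat.fib k : ℝ) ≠ 0 := by
    have := Nat.fib_pos.2 hk
    positivity
  have hd : gphi ^ k - gphi' ^ k ≠ 0 := by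
    intro h
    apply hk0
    rw [hf, h, zero_div]
  rw [gb_phi, gb_psi, hf, hf, Nat.add_sub_cancel, div_div_div_cancel_right₀ h5,
    div_mul_eq_mul_div, div_eq_div_iff (mul_ne_zero hd hx) hd]
  ring
end

section
/- If f(z) = ∑_{n=0}^∞ a_n z^n/n! is an entire function (i.e. for every z ∈ ℂ the series ∑_n a_n z^n/n! is summable), then for every integer k ≥ 1 the associated series ∑_{n=0}^∞ a_n z^n / F_n^{(k)}! is also summable for every z ∈ ℂ; i.e., the function _{(k)}f_F(z) = ∑_{n=0}^∞ a_n z^n / F_n^{(k)}! is entire. -/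
/-- The Fibonacci divisor factorial F_n^{(k)}! = ∏_{i=1}^n F_i^{(k)}, where
    F_i^{(k)} = F_{ik}/F_k, regarded as a complex scalar (empty product 1 for n = 0). -/
noncomputable def fibDivFactC (k n : ℕ) : ℂ :=
  ∏ i ∈ Finset.range n, ((Nat.fib ((i + 1) * k) : ℂ) / (Nat.fib k : ℂ))

theorem fibDiv_norm_bound (k : ℕ) (hk : 1 ≤ k) (n : ℕ) :
    (n.factorial : ℝ) ≤ (2 * (Nat.fib k : ℝ)) ^ n * ‖fibDivFactC k n‖ ∧ 0 < ‖fibDivFactC k n‖ := by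
  have hF : (0 : ℝ) < Nat.fib k := by exact_mod_cast Nat.fib_pos.2 hk
  induction n with
  | zero => simp [fibDivFactC]
  | succ n ih =>
    obtain ⟨h1, h2⟩ := ih
    have hG' : 0 < Nat.fib ((n + 1) * k) := Nat.fib_pos.2 (by positivity)
    have hG : (0 : ℝ) < Nat.fib ((n + 1) * k) := by exact_mod_cast hG'
    have e : ‖fibDivFactC k (n + 1)‖
        = ‖fibDivFactC k n‖ * ((Nat.fib ((n + 1) * k) : ℝ) / (Nat.fib k : ℝ)) := by
      simp [fibDivFactC, Finset.prod_range_succ]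
      field_simp
      ring
    have hle : n + 1 ≤ 2 * Nat.fib ((n + 1) * k) := by
      have := Nat.le_fib_add_one ((n + 1) * k)
      have h3 : (n + 1) * 1 ≤ (n + 1) * k := Nat.mul_le_mul_left _ hk
      omega
    have hle' : ((n + 1 : ℕ) : ℝ) ≤ 2 * (Nat.fib ((n + 1) * k) : ℝ) := by exact_mod_cast hle
    refine ⟨?_, by rw [e]; positivity⟩
    rw [e, Nat.factorial_succ, Nat.cast_mul]
    calc ((n + 1 : ℕ) : ℝ) * (n.factorial : ℝ)
        ≤ (2 * (Nat.fib ((n + 1) * k) : ℝ)) * ((2 * (Nat.fib k : ℝ)) ^ n * ‖fibDivFactC k n‖) := by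
          gcongr
      _ = _ := by
          field_simp
          ring

/-- If f(z) = ∑ a_n z^n/n! is entire (the series is summable for every z ∈ ℂ), then
    for every k ≥ 1 the series ∑ a_n z^n / F_n^{(k)}! is also summable for every z ∈ ℂ,
    i.e. the function _{(k)}f_F is entire. -/
theorem fib_divisor_entire (a : ℕ → ℂ)
    (hf : ∀ z : ℂ, Summable (fun n : ℕ => a n * z ^ n / n.factorial)) :
    ∀ k : ℕ, 1 ≤ k → ∀ z : ℂ, Summable (fun n : ℕ => a n * z ^ n / fibDivFactC k n) := by
  intro k hk z
  have hs := (hf ((2 * (Nat.fib k : ℂ)) * z)).norm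
  refine Summable.of_norm_bounded hs ?_
  intro n
  obtain ⟨h1, h2⟩ := fibDiv_norm_bound k hk n
  have h3 : (0 : ℝ) < n.factorial := by exact_mod_cast n.factorial_pos
  have e : ‖a n * (2 * (Nat.fib k : ℂ) * z) ^ n / n.factorial‖
      = ‖a n‖ * ((2 * (Nat.fib k : ℝ)) ^ n * ‖z‖ ^ n) / n.factorial := by
    simp [mul_pow]
  rw [e, norm_div, norm_mul, norm_pow, div_le_div_iff₀ h2 h3]
  calc ‖a n‖ * ‖z‖ ^ n * (n.factorial : ℝ)
      ≤ ‖a n‖ * ‖z‖ ^ n * ((2 * (Nat.fib k : ℝ)) ^ n * ‖fibDivFactC k n‖) := by gcongr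
    _ = _ := by ring
end
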